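/- For any claw-free graph G and any graph H, γ(G □ H) ≥ (2/3) · γ(G) · γ(H). -/

import Mathlib

/-- A set `S` dominates `G` if every vertex is in `S` or adjacent to a vertex of `S`. -/
def IsDomSet {V : Type*} (G : SimpleGraph V) (S : Set V) : Prop :=
  ∀ v : V, v ∈ S ∨ ∃ u ∈ S, G.Adj u v

/-- The domination number of a finite graph. -/
noncomputable def domNum {V : Type*} (G : SimpleGraph V) [Fintype V] : ℕ :=
  sInf {n | ∃ S : Finset V, IsDomSet G ↑S ∧ S.card = n}

/-- A graph is claw-free if it has no induced `K_{1,3}`. -/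
def ClawFree {V : Type*} (G : SimpleGraph V) : Prop :=
  IsEmpty (completeBipartiteGraph (Fin 1) (Fin 3) ↪g G)

theorem domNum_le_card {V : Type*} [Fintype V] (G : SimpleGraph V) (S : Finset V)
    (hS : IsDomSet G ↑S) : domNum G ≤ S.card :=
  Nat.sInf_le ⟨S, hS, rfl⟩

theorem exists_domNum {V : Type*} [Fintype V] (G : SimpleGraph V) :
    ∃ S : Finset V, IsDomSet G ↑S ∧ S.card = domNum G := by
  have h : {n | ∃ S : Finset V, IsDomSet G ↑S ∧ S.card = n}.Nonempty :=
    ⟨_, Finset.univ, fun v => Or.inl (by simp), rfl⟩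
  exact Nat.sInf_mem h

theorem no_claw {V : Type*} {G : SimpleGraph V} (hG : ClawFree G) {c x y z : V}
    (hx : G.Adj c x) (hy : G.Adj c y) (hz : G.Adj c z) (hxy : x ≠ y) (hxz : x ≠ z) (hyz : y ≠ z)
    (nxy : ¬ G.Adj x y) (nxz : ¬ G.Adj x z) (nyz : ¬ G.Adj y z) : False := by
  have nyx : ¬ G.Adj y x := fun h => nxy h.symm
  have nzx : ¬ G.Adj z x := fun h => nxz h.symm
  have nzy : ¬ G.Adj z y := fun h => nyz h.symm
  refine hG.false ⟨⟨Sum.elim (fun _ => c) ![x, y, z], ?_⟩, ?_⟩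
  · have := hx.ne
    have := hy.ne
    have := hz.ne
    rintro (a | a) (b | b) h
    · congr 1; exact Subsingleton.elim _ _
    · fin_cases b <;> simp_all
    · fin_cases a <;> simp_all
    · fin_cases a <;> fin_cases b <;> simp_all
  · rintro (a | a) (b | b)
    · change G.Adj c c ↔ _
      simp
    · change G.Adj c (![x, y, z] b) ↔ _
      fin_cases b <;> simp [hx, hy, hz]
    · change G.Adj (![x, y, z] a) c ↔ _
      fin_cases a <;> simp [hx.symm, hy.symm, hz.symm]
    · change G.Adj (![x, y, z] a) (![x, y, z] b) ↔ _
      fin_cases a <;> fin_cases b <;> simp [nxy, nxz, nyz, nyx, nzx, nzy]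

theorem exists_max_indep {V : Type*} (G : SimpleGraph V) (X : Finset V) :
    ∃ J ⊆ X, (∀ a ∈ J, ∀ b ∈ J, ¬ G.Adj a b) ∧ ∀ x ∈ X, x ∈ J ∨ ∃ j ∈ J, G.Adj j x := by
  classical
  obtain ⟨p, hp⟩ : ∃ p : Finset V → Prop, ∀ J, p J ↔ ∀ a ∈ J, ∀ b ∈ J, ¬ G.Adj a b :=
    ⟨_, fun J => Iff.rfl⟩
  obtain ⟨J, hJ, hmax⟩ := Finset.exists_max_image
    (X.powerset.filter p) Finset.card ⟨∅, by simp [hp]⟩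
  rw [Finset.mem_filter, Finset.mem_powerset, hp] at hJ
  refine ⟨J, hJ.1, hJ.2, fun x hx => ?_⟩
  by_contra! hcon
  have := hmax (insert x J) (by
    rw [Finset.mem_filter, Finset.mem_powerset, hp]
    refine ⟨Finset.insert_subset hx hJ.1, fun a ha b hb hab => ?_⟩
    rw [Finset.mem_insert] at ha hb
    rcases ha with rfl | ha <;> rcases hb with rfl | hb
    · exact hab.ne rfl
    · exact hcon.2 b hb hab.symm
    · exact hcon.2 a ha hab
    · exact hJ.2 a ha b hb hab)
  rw [Finset.card_insert_of_notMem hcon.1] at this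
  omega

/-- Allan-Laskar: claw-free graphs have an independent minimum dominating set. -/
theorem exists_indep_dom {V : Type*} [Fintype V] {G : SimpleGraph V} (hG : ClawFree G) :
    ∃ I : Finset V, (∀ a ∈ I, ∀ b ∈ I, ¬ G.Adj a b) ∧
      (∀ v, ∃ i ∈ I, i = v ∨ G.Adj i v) ∧ I.card ≤ domNum G := by
  classical
  obtain ⟨D, hD, hc⟩ := exists_domNum G
  obtain ⟨I, hID, hI, hIm⟩ := exists_max_indep G D
  obtain ⟨J, hJX, hJ, hJm⟩ := exists_max_indep G
    (Finset.univ.filter (fun v => v ∉ I ∧ ∀ i ∈ I, ¬ G.Adj i v))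
  simp only [Finset.mem_filter, Finset.mem_univ, true_and] at hJm
  have hJ2 : ∀ v ∈ J, v ∉ I ∧ ∀ i ∈ I, ¬ G.Adj i v := fun v hv => by simpa using hJX hv
  refine ⟨I ∪ J, ?_, ?_, ?_⟩
  · intro a ha b hb hab
    rw [Finset.mem_union] at ha hb
    rcases ha with ha | ha <;> rcases hb with hb | hb
    · exact hI a ha b hb hab
    · exact (hJ2 b hb).2 a ha hab
    · exact (hJ2 a ha).2 b hb hab.symm
    · exact hJ a ha b hb hab
  · intro v
    by_cases h : v ∉ I ∧ ∀ i ∈ I, ¬ G.Adj i v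
    · rcases hJm v h with h | ⟨j, hj, h⟩
      · exact ⟨v, by simp [h], Or.inl rfl⟩
      · exact ⟨j, by simp [hj], Or.inr h⟩
    · by_cases hv : v ∈ I
      · exact ⟨v, by simp [hv], Or.inl rfl⟩
      · push Not at h
        obtain ⟨i, hi, h⟩ := h hv
        exact ⟨i, by simp [hi], Or.inr h⟩
  · have key : ∀ x ∈ J, ∃ d ∈ D \ I, G.Adj d x := by
      intro x hx
      have hx2 := hJ2 x hx
      rcases hD x with h | ⟨u, hu, h⟩
      · rcases hIm x h with h | ⟨j, hj, h⟩
        · exact absurd h hx2.1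
        · exact absurd h (hx2.2 j hj)
      · refine ⟨u, ?_, h⟩
        rw [Finset.mem_sdiff]
        exact ⟨hu, fun hui => hx2.2 u hui h⟩
    choose! f hf hfa using key
    have hle : J.card ≤ (D \ I).card := by
      refine Finset.card_le_card_of_injOn f (fun x hx => hf x hx) ?_
      intro x hx y hy hxy
      by_contra hne
      have hx' : x ∈ J := hx
      have hy' : y ∈ J := hy
      have hd := hf x hx'
      rw [Finset.mem_sdiff] at hd
      rcases hIm _ hd.1 with h | ⟨i, hi, hia⟩
      · exact hd.2 h
      · have hy2 := hfa y hy'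
        rw [← hxy] at hy2
        exact no_claw hG hia.symm (hfa x hx') hy2
          (fun e => (hJ2 x hx').1 (e ▸ hi)) (fun e => (hJ2 y hy').1 (e ▸ hi)) hne
          ((hJ2 x hx').2 i hi) ((hJ2 y hy').2 i hi) (hJ x hx' y hy')
    have h1 := Finset.card_union_le I J
    have h2 := Finset.card_sdiff_add_card_eq_card hID
    omega

/-- Discharging count. -/
theorem count_cells {α β : Type*} [DecidableEq α] [DecidableEq β] (D : Finset α)
    (L : α → Finset β) (hL : ∀ d ∈ D, (L d).card = 1 ∨ (L d).card = 2) :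
    2 * (D.biUnion L).card + (D.filter (fun d => (L d).card = 1)).card ≤
      3 * D.card +
      (D.filter (fun d => (L d).card = 2 ∧ ∀ e ∈ D, e ≠ d → Disjoint (L e) (L d))).card := by
  set g : β → ℕ := fun c => (D.filter (fun d => c ∈ L d)).card with hg
  have gpos : ∀ d ∈ D, ∀ c ∈ L d, 1 ≤ g c := fun d hd c hc =>
    Finset.card_pos.mpr ⟨d, by simp [hd, hc]⟩
  have gle : ∀ d ∈ D, ∀ c ∈ L d, (g c : ℚ)⁻¹ ≤ 1 := fun d hd c hc =>
    inv_le_one_of_one_le₀ (by exact_mod_cast gpos d hd c hc)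
  have e1 : ((D.biUnion L).card : ℚ) = ∑ d ∈ D, ∑ c ∈ L d, (g c : ℚ)⁻¹ := by
    have : ∀ d ∈ D, ∑ c ∈ L d, (g c : ℚ)⁻¹ =
        ∑ c ∈ D.biUnion L, if c ∈ L d then (g c : ℚ)⁻¹ else 0 := by
      intro d hd
      rw [← Finset.sum_filter]
      refine Finset.sum_congr ?_ fun _ _ => rfl
      ext c
      simp only [Finset.mem_filter, Finset.mem_biUnion]
      exact ⟨fun h => ⟨⟨d, hd, h⟩, h⟩, fun h => h.2⟩
    rw [Finset.sum_congr rfl this, Finset.sum_comm, Finset.card_eq_sum_ones, Nat.cast_sum]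
    refine Finset.sum_congr rfl fun c hc => ?_
    rw [Finset.mem_biUnion] at hc
    obtain ⟨d, hd, hc⟩ := hc
    have := gpos d hd c hc
    rw [← Finset.sum_filter, Finset.sum_const, nsmul_eq_mul]
    change _ = (g c : ℚ) * _
    rw [mul_inv_cancel₀ (by positivity)]
    simp
  have e2 : ∀ d ∈ D, 2 * ∑ c ∈ L d, (g c : ℚ)⁻¹ + (if (L d).card = 1 then 1 else 0) ≤
      3 + (if (L d).card = 2 ∧ ∀ e ∈ D, e ≠ d → Disjoint (L e) (L d) then 1 else 0) := by
    intro d hd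
    rcases hL d hd with h | h
    · rw [if_pos h, if_neg (by omega)]
      have := Finset.sum_le_card_nsmul (L d) (fun c => (g c : ℚ)⁻¹) 1 (gle d hd)
      rw [h] at this
      simp at this
      linarith
    · rw [if_neg (by omega)]
      by_cases hp : ∀ e ∈ D, e ≠ d → Disjoint (L e) (L d)
      · rw [if_pos ⟨h, hp⟩]
        have := Finset.sum_le_card_nsmul (L d) (fun c => (g c : ℚ)⁻¹) 1 (gle d hd)
        rw [h] at this
        simp at this
        linarith
      · rw [if_neg (fun q => hp q.2)]
        push Not at hp
        obtain ⟨e, he, hed, hdis⟩ := hp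
        rw [Finset.not_disjoint_iff] at hdis
        obtain ⟨c, hce, hcd⟩ := hdis
        have g2 : 2 ≤ g c := by
          have : ({e, d} : Finset α) ⊆ D.filter (fun d => c ∈ L d) := by
            intro x hx
            simp only [Finset.mem_insert, Finset.mem_singleton] at hx
            rcases hx with rfl | rfl <;> simp [*]
          have := Finset.card_le_card this
          rwa [Finset.card_pair hed] at this
        have g3 : (g c : ℚ)⁻¹ ≤ 2⁻¹ := inv_anti₀ (by norm_num) (by exact_mod_cast g2)
        rw [← Finset.add_sum_erase _ _ hcd]
        have := Finset.sum_le_card_nsmul ((L d).erase c) (fun c => (g c : ℚ)⁻¹) 1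
          (fun x hx => gle d hd x (Finset.mem_of_mem_erase hx))
        rw [Finset.card_erase_of_mem hcd, h] at this
        simp at this
        norm_num at g3
        linarith
  have e3 := Finset.sum_le_sum e2
  rw [Finset.sum_add_distrib, Finset.sum_add_distrib, ← Finset.mul_sum, ← e1,
    Finset.sum_boole, Finset.sum_boole, Finset.sum_const, nsmul_eq_mul] at e3
  have : (2 * (D.biUnion L).card + (D.filter (fun d => (L d).card = 1)).card : ℚ) ≤
      3 * D.card +
      (D.filter (fun d => (L d).card = 2 ∧ ∀ e ∈ D, e ≠ d → Disjoint (L e) (L d))).card := by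
    linarith
  exact_mod_cast this

theorem main_bound {V W : Type*} [Fintype V] [Fintype W]
    (G : SimpleGraph V) (H : SimpleGraph W) (hG : ClawFree G)
    (D : Finset (V × W)) (hD : IsDomSet (G.boxProd H) ↑D) :
    2 * (domNum G * domNum H) ≤ 3 * D.card := by
  classical
  obtain ⟨I, hI, hIdom, hIc⟩ := exists_indep_dom hG
  have hIc' : domNum G ≤ I.card := domNum_le_card G I (fun v => by
    obtain ⟨i, hi, h⟩ := hIdom v
    rcases h with rfl | h
    · exact Or.inl hi
    · exact Or.inr ⟨i, hi, h⟩)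
  set L : V × W → Finset (V × W) := fun d =>
    Finset.univ.filter (fun c => c.2 = d.2 ∧ c.1 ∈ I ∧ (c.1 = d.1 ∨ G.Adj c.1 d.1)) with hLdef
  have memL : ∀ c d, c ∈ L d ↔ c.2 = d.2 ∧ c.1 ∈ I ∧ (c.1 = d.1 ∨ G.Adj c.1 d.1) := by
    intro c d; simp [hLdef]
  have Lu : ∀ i ∈ I, ∀ h, L (i, h) = {(i, h)} := by
    intro i hi h
    ext c
    rw [memL, Finset.mem_singleton]
    constructor
    · rintro ⟨h1, h2, h3 | h3⟩
      · exact Prod.ext h3 h1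
      · exact absurd h3 (hI _ h2 _ hi)
    · rintro rfl
      exact ⟨rfl, hi, Or.inl rfl⟩
  have Lpos : ∀ d, 1 ≤ (L d).card := by
    intro d
    obtain ⟨i, hi, h⟩ := hIdom d.1
    exact Finset.card_pos.mpr ⟨(i, d.2), by rw [memL]; exact ⟨rfl, hi, h⟩⟩
  have Ladj : ∀ d, 2 ≤ (L d).card → ∀ c ∈ L d, G.Adj c.1 d.1 := by
    intro d hd c hc
    rw [memL] at hc
    rcases hc.2.2 with h | h
    · have := Lu d.1 (h ▸ hc.2.1) d.2
      rw [Prod.mk.eta] at this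
      rw [this] at hd
      simp at hd
    · exact h
  have Lne : ∀ d, ∀ c ∈ L d, ∀ c' ∈ L d, c ≠ c' → c.1 ≠ c'.1 := by
    intro d c hc c' hc' hne h
    rw [memL] at hc hc'
    exact hne (Prod.ext h (hc.1.trans hc'.1.symm))
  have LI : ∀ d, ∀ c ∈ L d, c.1 ∈ I := fun d c hc => ((memL c d).1 hc).2.1
  have Lle : ∀ d, (L d).card ≤ 2 := by
    intro d
    by_contra! hcon
    obtain ⟨a, b, c, ha, hb, hc, hab, hac, hbc⟩ := Finset.two_lt_card_iff.1 hcon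
    have h2 : 2 ≤ (L d).card := by omega
    exact no_claw hG (Ladj d h2 a ha).symm (Ladj d h2 b hb).symm (Ladj d h2 c hc).symm
      (Lne d a ha b hb hab) (Lne d a ha c hc hac) (Lne d b hb c hc hbc)
      (hI _ (LI d a ha) _ (LI d b hb)) (hI _ (LI d a ha) _ (LI d c hc))
      (hI _ (LI d b hb) _ (LI d c hc))
  have L12 : ∀ d, (L d).card = 1 ∨ (L d).card = 2 := by
    intro d
    have := Lpos d
    have := Lle d
    omega
  set P := D.biUnion L with hP
  set A := D.filter (fun d => (L d).card = 1) with hA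
  set R := D.filter (fun d => (L d).card = 2 ∧ ∀ e ∈ D, e ≠ d → Disjoint (L e) (L d)) with hR
  have hcount : 2 * P.card + A.card ≤ 3 * D.card + R.card := by
    convert count_cells D L (fun d _ => L12 d)
  have memR : ∀ d, d ∈ R ↔ d ∈ D ∧ (L d).card = 2 ∧ ∀ e ∈ D, e ≠ d → Disjoint (L e) (L d) := by
    intro d; simp [hR]
  have memP : ∀ c, c ∈ P ↔ ∃ d ∈ D, c ∈ L d := by intro c; simp [hP]
  -- uniqueness for pairs
  have Runiq : ∀ d ∈ R, ∀ e ∈ D, ∀ c, c ∈ L d → c ∈ L e → e = d := by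
    intro d hd e he c hc hc'
    by_contra hne
    exact Finset.disjoint_left.1 (((memR d).1 hd).2.2 e he hne) hc' hc
  obtain ⟨U, hU, hUmax⟩ := Finset.exists_max_image
    ((Finset.univ : Finset (Finset (V × W))).filter (fun U =>
      (∀ c ∈ U, ∃ d ∈ R, c ∈ L d) ∧
      (∀ d ∈ R, ∀ c ∈ L d, ∀ c' ∈ L d, c ∈ U → c' ∈ U → c = c') ∧
      (∀ c ∈ U, ∃ h, H.Adj c.2 h ∧ (c.1, h) ∈ P ∧ (c.1, h) ∉ U))) Finset.card ⟨∅, by simp⟩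
  rw [Finset.mem_filter] at hU
  obtain ⟨-, hU1, hU2, hU3⟩ := hU
  have hUP : U ⊆ P := by
    intro c hc
    obtain ⟨d, hd, hcd⟩ := hU1 c hc
    exact (memP c).2 ⟨d, ((memR d).1 hd).1, hcd⟩
  -- rows of `P \ U` dominate `H`
  have hrow : ∀ i ∈ I, domNum H ≤ ((P \ U).filter (fun c => c.1 = i)).card := by
    intro i hi
    refine (domNum_le_card H (((P \ U).filter (fun c => c.1 = i)).image Prod.snd) ?_).trans
      Finset.card_image_le
    have mk : ∀ h, (i, h) ∈ P → (i, h) ∉ U →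
        h ∈ ((P \ U).filter (fun c => c.1 = i)).image Prod.snd := by
      intro h h1 h2
      exact Finset.mem_image.2 ⟨(i, h), by simp [h1, h2], rfl⟩
    intro h
    have hpres : ∀ w, (w, h) ∈ D → (i = w ∨ G.Adj i w) →
        h ∈ (↑(((P \ U).filter (fun c => c.1 = i)).image Prod.snd) : Set W) ∨
        ∃ u ∈ (↑(((P \ U).filter (fun c => c.1 = i)).image Prod.snd) : Set W), H.Adj u h := by
      intro w hw hiw
      have hp : (i, h) ∈ P := (memP _).2 ⟨(w, h), hw, (memL _ _).2 ⟨rfl, hi, hiw⟩⟩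
      by_cases hu : (i, h) ∈ U
      · obtain ⟨h', h1, h2, h3⟩ := hU3 _ hu
        exact Or.inr ⟨h', mk h' h2 h3, h1.symm⟩
      · exact Or.inl (mk h hp hu)
    rcases hD (i, h) with hd | ⟨⟨w, h'⟩, hd, hadj⟩
    · exact hpres i hd (Or.inl rfl)
    · rw [SimpleGraph.boxProd_adj] at hadj
      rcases hadj with ⟨ha, hh⟩ | ⟨ha, hh⟩
      · simp only at ha hh
        subst hh
        exact hpres w hd (Or.inr ha.symm)
      · simp only at ha hh
        subst hh
        have hmem : (w, h') ∈ L (w, h') := by rw [Lu w hi]; simp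
        refine Or.inr ⟨h', mk h' ((memP _).2 ⟨(w, h'), hd, hmem⟩) ?_, ha⟩
        intro hu
        obtain ⟨d, hdR, hcd⟩ := hU1 _ hu
        have := Runiq d hdR _ hd _ hcd hmem
        have h2 := ((memR d).1 hdR).2.1
        rw [← this, Lu w hi] at h2
        simp at h2
  have hsum : I.card * domNum H ≤ (P \ U).card := by
    have h1 : (((P \ U)).card) = ∑ i ∈ I, ((P \ U).filter (fun c => c.1 = i)).card := by
      refine Finset.card_eq_sum_card_fiberwise (f := Prod.fst) ?_
      intro c hc
      have hc' : c ∈ P \ U := hc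
      obtain ⟨d, _, hcd⟩ := (memP c).1 (Finset.mem_sdiff.1 hc').1
      exact LI d c hcd
    rw [h1, ← smul_eq_mul]
    exact Finset.card_nsmul_le_sum _ _ _ hrow
  -- classify the pairs
  set hit := R.filter (fun d => ∃ c ∈ L d, c ∈ U) with hhit
  set rel : V × W → Prop := fun d => ∃ c ∈ L d, ∃ c' ∈ U, c.1 = c'.1 ∧ H.Adj c'.2 c.2 ∧
    ∀ h, H.Adj c'.2 h → (c'.1, h) ∈ P → (c'.1, h) ∉ U → h = c.2 with hrel
  set N := R.filter (fun d => ¬ ∃ c ∈ L d, c ∈ U) with hN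
  have c1 : hit.card ≤ U.card := by
    have : ∀ d ∈ hit, ∃ c, c ∈ L d ∧ c ∈ U := by
      intro d hd
      obtain ⟨c, h1, h2⟩ := (Finset.mem_filter.1 hd).2
      exact ⟨c, h1, h2⟩
    choose! f hf1 hf2 using this
    refine Finset.card_le_card_of_injOn f (fun x hx => hf2 x hx) ?_
    intro x hx y hy hxy
    have hx' : x ∈ hit := hx
    have hy' : y ∈ hit := hy
    refine Runiq y (Finset.mem_filter.1 hy').1 x
      ((memR x).1 (Finset.mem_filter.1 hx').1).1 (f x) ?_ (hf1 x hx')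
    rw [hxy]; exact hf1 y hy'
  have c2 : (N.filter rel).card ≤ U.card := by
    have : ∀ d ∈ N.filter rel, ∃ c', c' ∈ U ∧ ∃ c ∈ L d, c.1 = c'.1 ∧ H.Adj c'.2 c.2 ∧
        ∀ h, H.Adj c'.2 h → (c'.1, h) ∈ P → (c'.1, h) ∉ U → h = c.2 := by
      intro d hd
      obtain ⟨c, h1, c', h2, h3⟩ := (Finset.mem_filter.1 hd).2
      exact ⟨c', h2, c, h1, h3⟩
    choose! f hf1 g hg1 hg2 hg3 hg4 using this
    refine Finset.card_le_card_of_injOn f (fun x hx => hf1 x hx) ?_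
    intro x hx y hy hxy
    have hx' : x ∈ N.filter rel := hx
    have hy' : y ∈ N.filter rel := hy
    have hxN := Finset.mem_filter.1 (Finset.mem_filter.1 hx').1
    have hyN := Finset.mem_filter.1 (Finset.mem_filter.1 hy').1
    have hgx : g x = g y := by
      have e1 : (g x).1 = (g y).1 := by rw [hg2 x hx', hg2 y hy', hxy]
      refine Prod.ext e1 ?_
      have e2 : ((f y).1, (g x).2) = g x := Prod.ext (by rw [← hxy, hg2 x hx']) rfl
      refine hg4 y hy' (g x).2 (hxy ▸ hg3 x hx') ?_ ?_
      · rw [e2]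
        exact (memP _).2 ⟨x, ((memR x).1 hxN.1).1, hg1 x hx'⟩
      · rw [e2]
        exact fun hu => hxN.2 ⟨g x, hg1 x hx', hu⟩
    exact Runiq y hyN.1 x ((memR x).1 hxN.1).1 (g x) (hgx ▸ hg1 y hy') (hg1 x hx')
  set F := N.filter (fun d => ¬ rel d) with hF
  have hFprop : ∀ d ∈ F, ∀ c ∈ L d, ∀ h, H.Adj c.2 h → (c.1, h) ∈ P → (c.1, h) ∈ U := by
    intro d hd c hc h hadj hp
    by_contra hnu
    have hdF := Finset.mem_filter.1 hd
    have hdN := Finset.mem_filter.1 hdF.1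
    have hcU : c ∉ U := fun hu => hdN.2 ⟨c, hc, hu⟩
    have := hUmax (insert c U) (by
      rw [Finset.mem_filter]
      refine ⟨Finset.mem_univ _, ?_, ?_, ?_⟩
      · intro x hx
        rcases Finset.mem_insert.1 hx with rfl | hx
        · exact ⟨d, hdN.1, hc⟩
        · exact hU1 x hx
      · intro e he x hx y hy hxU hyU
        have aux : ∀ z, c ∈ L e → z ∈ L e → z ∉ U := by
          intro z hce hz hzU
          have := Runiq d hdN.1 e ((memR e).1 he).1 c hc hce
          subst this
          exact hdN.2 ⟨z, hz, hzU⟩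
        rcases Finset.mem_insert.1 hxU with rfl | hxV <;>
          rcases Finset.mem_insert.1 hyU with rfl | hyV
        · rfl
        · exact absurd hyV (aux y hx hy)
        · exact absurd hxV (aux x hy hx)
        · exact hU2 e he x hx y hy hxV hyV
      · intro x hx
        rcases Finset.mem_insert.1 hx with rfl | hx
        · refine ⟨h, hadj, hp, ?_⟩
          rw [Finset.mem_insert]
          rintro (e | e)
          · exact hadj.ne (congrArg Prod.snd e).symm
          · exact hnu e
        · obtain ⟨h1, k1, k2, k3⟩ := hU3 x hx
          by_cases hxc : (x.1, h1) = c
          · by_contra! hcon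
            refine hdF.2 ⟨c, hc, x, hx, ?_, ?_, ?_⟩
            · rw [← hxc]
            · rw [← hxc]; exact k1
            · intro h2 q1 q2 q3
              have := hcon h2 q1 q2
              rcases Finset.mem_insert.1 this with e | e
              · rw [← e]
              · exact absurd e q3
          · refine ⟨h1, k1, k2, ?_⟩
            rw [Finset.mem_insert]
            rintro (e | e)
            · exact hxc e
            · exact k3 e)
    rw [Finset.card_insert_of_notMem hcU] at this
    omega
  have hFR : ∀ d ∈ F, d ∈ R := fun d hd =>
    (Finset.mem_filter.1 (Finset.mem_filter.1 hd).1).1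
  have hFD : ∀ d ∈ F, d ∈ D := fun d hd => ((memR d).1 (hFR d hd)).1
  -- layer bound
  have hlayer : ∀ h : W, (F.filter (fun d => d.2 = h)).card ≤ (A.filter (fun d => d.2 = h)).card := by
    intro h
    set Fh := F.filter (fun d => d.2 = h) with hFh
    set Ah := A.filter (fun d => d.2 = h) with hAh
    have memFh : ∀ d, d ∈ Fh ↔ d ∈ F ∧ d.2 = h := by intro d; simp [hFh]
    set T := (Fh.biUnion L).image Prod.fst with hT
    have memT : ∀ i, i ∈ T ↔ ∃ d ∈ Fh, (i, h) ∈ L d := by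
      intro i
      rw [hT, Finset.mem_image]
      constructor
      · rintro ⟨c, hc, rfl⟩
        obtain ⟨d, hd, hcd⟩ := Finset.mem_biUnion.1 hc
        have : c.2 = h := ((memL _ _).1 hcd).1.trans ((memFh d).1 hd).2
        exact ⟨d, hd, by rw [← this]; exact hcd⟩
      · rintro ⟨d, hd, hcd⟩
        exact ⟨(i, h), Finset.mem_biUnion.2 ⟨d, hd, hcd⟩, rfl⟩
    have hTc : T.card = Fh.card * 2 := by
      rw [hT, Finset.card_image_of_injOn, Finset.card_biUnion]
      · refine Finset.sum_const_nat fun d hd => ?_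
        exact ((memR d).1 (hFR d ((memFh d).1 hd).1)).2.1
      · intro x hx y hy hxy
        exact ((memR y).1 (hFR y ((memFh y).1 hy).1)).2.2 x (hFD x ((memFh x).1 hx).1) hxy
      · intro x hx y hy hxy
        have hx' : x ∈ Fh.biUnion L := hx
        have hy' : y ∈ Fh.biUnion L := hy
        obtain ⟨d, hd, hcd⟩ := Finset.mem_biUnion.1 hx'
        obtain ⟨e, he, hce⟩ := Finset.mem_biUnion.1 hy'
        refine Prod.ext hxy ?_
        rw [((memL _ _).1 hcd).1, ((memL _ _).1 hce).1, ((memFh d).1 hd).2, ((memFh e).1 he).2]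
    have hTI : T ⊆ I := by
      intro i hi
      obtain ⟨d, _, hcd⟩ := (memT i).1 hi
      exact LI d _ hcd
    have hS : IsDomSet G (↑((I \ T) ∪ (Fh.image Prod.fst ∪ Ah.image Prod.fst)) : Set V) := by
      intro x
      have fin : ∀ y ∈ (I \ T) ∪ (Fh.image Prod.fst ∪ Ah.image Prod.fst), (y = x ∨ G.Adj y x) →
          x ∈ (↑((I \ T) ∪ (Fh.image Prod.fst ∪ Ah.image Prod.fst)) : Set V) ∨
          ∃ u ∈ (↑((I \ T) ∪ (Fh.image Prod.fst ∪ Ah.image Prod.fst)) : Set V), G.Adj u x := by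
        rintro y hy (rfl | ha)
        · exact Or.inl hy
        · exact Or.inr ⟨y, hy, ha⟩
      by_cases hx : ∃ i ∈ I \ T, i = x ∨ G.Adj i x
      · obtain ⟨i, hi, hix⟩ := hx
        exact fin i (Finset.mem_union_left _ hi) hix
      have hxT : ∀ i ∈ I, (i = x ∨ G.Adj i x) → i ∈ T := by
        intro i hi hix
        by_contra hiT
        exact hx ⟨i, Finset.mem_sdiff.2 ⟨hi, hiT⟩, hix⟩
      -- horizontal domination
      have hor : ∀ w, (w, h) ∈ D → (w = x ∨ G.Adj w x) →
          w ∈ (I \ T) ∪ (Fh.image Prod.fst ∪ Ah.image Prod.fst) := by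
        intro w hw hwx
        refine Finset.mem_union_right _ (Finset.mem_union.2 ?_)
        rcases L12 (w, h) with h1 | h2
        · refine Or.inr (Finset.mem_image.2 ⟨(w, h), ?_, rfl⟩)
          simp [hAh, hA, hw, h1]
        · left
          have hcom : ∃ c ∈ L (w, h), c.1 = x ∨ G.Adj c.1 x := by
            by_contra! hcon
            obtain ⟨p, q, hpq, hL2⟩ := Finset.card_eq_two.1 h2
            have hp : p ∈ L (w, h) := by rw [hL2]; simp
            have hq : q ∈ L (w, h) := by rw [hL2]; simp
            have hap := Ladj _ h2.ge p hp
            have haq := Ladj _ h2.ge q hq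
            rcases hwx with rfl | hwx
            · exact (hcon p hp).2 hap
            · exact no_claw hG hap.symm haq.symm hwx (Lne _ p hp q hq hpq) (hcon p hp).1
                (hcon q hq).1 (hI _ (LI _ p hp) _ (LI _ q hq)) (hcon p hp).2 (hcon q hq).2
          obtain ⟨c, hc, hcx⟩ := hcom
          obtain ⟨d, hd, hcd⟩ := (memT c.1).1 (hxT c.1 (LI _ c hc) hcx)
          have hc2 : (c.1, h) = c := Prod.ext rfl ((memL _ _).1 hc).1.symm
          rw [hc2] at hcd
          have := Runiq d (hFR d ((memFh d).1 hd).1) _ hw c hcd hc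
          exact Finset.mem_image.2 ⟨d, hd, by rw [← this]⟩
      rcases hD (x, h) with hd | ⟨⟨w, h'⟩, hd, hadj⟩
      · exact fin x (hor x hd (Or.inl rfl)) (Or.inl rfl)
      · rw [SimpleGraph.boxProd_adj] at hadj
        rcases hadj with ⟨ha, hh⟩ | ⟨ha, hh⟩
        · simp only at ha hh
          subst hh
          exact fin w (hor w hd (Or.inr ha)) (Or.inr ha)
        · exfalso
          simp only at ha hh
          subst hh
          -- every label cell of that vertex is removed
          have allU : ∀ c ∈ L (w, h'), c ∈ U := by
            intro c hc
            have hcm := (memL _ _).1 hc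
            obtain ⟨d, hdF, hcd⟩ := (memT c.1).1 (hxT c.1 hcm.2.1 hcm.2.2)
            have hc2 : (c.1, h') = c := Prod.ext rfl hcm.1.symm
            have := hFprop d ((memFh d).1 hdF).1 (c.1, h) hcd h' ha.symm (by
              simp only
              rw [hc2]
              exact (memP c).2 ⟨_, hd, hc⟩)
            simp only at this
            rwa [hc2] at this
          obtain ⟨c, hc⟩ := Finset.card_pos.1 (Lpos (w, h'))
          obtain ⟨e, heR, hce⟩ := hU1 c (allU c hc)
          have hee := Runiq e heR _ hd c hce hc
          rw [← hee] at heR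
          have h2 := ((memR _).1 heR).2.1
          obtain ⟨p, q, hpq, hL2⟩ := Finset.card_eq_two.1 h2
          have hp : p ∈ L (w, h') := by rw [hL2]; simp
          have hq : q ∈ L (w, h') := by rw [hL2]; simp
          exact hpq (hU2 _ heR p hp q hq (allU p hp) (allU q hq))
    have h1 := domNum_le_card G _ hS
    have h2 := Finset.card_union_le (I \ T) (Fh.image Prod.fst ∪ Ah.image Prod.fst)
    have h3 := Finset.card_union_le (Fh.image Prod.fst) (Ah.image Prod.fst)
    have h4 : (Fh.image Prod.fst).card ≤ Fh.card := Finset.card_image_le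
    have h5 : (Ah.image Prod.fst).card ≤ Ah.card := Finset.card_image_le
    have h6 := Finset.card_sdiff_add_card_eq_card hTI
    omega
  have c3 : F.card ≤ A.card := by
    rw [Finset.card_eq_sum_card_fiberwise (f := Prod.snd) (s := F) (t := Finset.univ)
      (fun _ _ => by simp),
      Finset.card_eq_sum_card_fiberwise (f := Prod.snd) (s := A) (t := Finset.univ)
      (fun _ _ => by simp)]
    exact Finset.sum_le_sum fun h _ => hlayer h
  have p1 : hit.card + N.card = R.card := Finset.card_filter_add_card_filter_not _
  have p2 : (N.filter rel).card + F.card = N.card := Finset.card_filter_add_card_filter_not _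
  have p3 := Finset.card_sdiff_add_card_eq_card hUP
  have p4 : domNum G * domNum H ≤ I.card * domNum H := Nat.mul_le_mul_right _ hIc'
  omega

theorem stmt_4 {V W : Type*} [Fintype V] [Fintype W]
    (G : SimpleGraph V) (H : SimpleGraph W) (hG : ClawFree G) :
    (domNum (G.boxProd H) : ℚ) ≥ (2 / 3 : ℚ) * domNum G * domNum H := by
  obtain ⟨D, hD, hc⟩ := exists_domNum (G.boxProd H)
  have h := main_bound G H hG D hD
  rw [hc] at h
  have h' : (2 * (domNum G * domNum H) : ℚ) ≤ 3 * domNum (G.boxProd H) := by exact_mod_cast h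
  linarith
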